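/- For all integers k ≥ 3, n ≥ 3 and m ≥ 0, the number of m-edge matchings of the cycle on kn vertices satisfies a(C_{kn}, m) = Σ_{i=0}^{⌊m/n⌋} (−1)^{i(n−1)} · a(C_k, i) · a((k−2i)·C_n, m − i·n), where (k−2i)·C_n denotes the disjoint union of k−2i copies of the cycle on n vertices. -/

import Mathlib

open Polynomial


noncomputable section

/-- Number of matchings with exactly `m` edges in a simple graph `G`. -/
def matchingCount {V : Type*} (G : SimpleGraph V) (m : ℕ) : ℕ :=
  Nat.card {M : Finset (Sym2 V) //
    M.card = m ∧ (∀ e ∈ M, e ∈ G.edgeSet) ∧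
    ∀ e ∈ M, ∀ f ∈ M, e ≠ f → ∀ v : V, v ∈ e → v ∉ f}

/-- The matching polynomial of a finite simple graph. -/
def matchingPoly {V : Type*} [Fintype V] (G : SimpleGraph V) : ℚ[X] :=
  ∑ i ∈ Finset.range (Fintype.card V + 1),
    Polynomial.C ((-1 : ℚ) ^ i * (matchingCount G i : ℚ)) * X ^ (Fintype.card V - 2 * i)

/-- Matching polynomial of the path graph on `n` vertices (via the recurrence). -/
def pathPoly : ℕ → ℚ[X]
  | 0 => 1
  | 1 => X
  | n + 2 => X * pathPoly (n + 1) - pathPoly n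

/-- Matching polynomial of the cycle graph on `n` vertices (via the recurrence). -/
def cyclePoly : ℕ → ℚ[X]
  | 0 => 2
  | 1 => X
  | n + 2 => X * cyclePoly (n + 1) - cyclePoly n

/-- The degree-`d` cover of the `n`-cycle determined by the labeling `lam`. -/
def coverGraph (n d : ℕ) (lam : ZMod n → Equiv.Perm (Fin d)) :
    SimpleGraph (ZMod n × Fin d) :=
  SimpleGraph.fromRel fun p q => q.1 = p.1 + 1 ∧ q.2 = lam p.1 p.2

/-- Number of cycles of length `i` (fixed points counted as 1-cycles) of `σ`. -/
def cycleCount {d : ℕ} (σ : Equiv.Perm (Fin d)) (i : ℕ) : ℕ :=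
  (Finset.univ.filter fun x : Fin d => Function.minimalPeriod σ x = i).card / i

/-- The product `λ(n-1) ∘ ⋯ ∘ λ(0)` (applying `λ(0)` first). -/
def cycleProd (n d : ℕ) (lam : ZMod n → Equiv.Perm (Fin d)) : Equiv.Perm (Fin d) :=
  (((List.range n).map fun i => lam (i : ZMod n)).reverse).prod
/-- The cycle graph on `m` vertices (on the vertex set `ZMod m`). -/
def cycleGraph (m : ℕ) : SimpleGraph (ZMod m) :=
  SimpleGraph.fromRel fun a b => b = a + 1

/-- The disjoint union of `ℓ` copies of the cycle graph on `n` vertices. -/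
def cyclesUnion (ℓ n : ℕ) : SimpleGraph (Fin ℓ × ZMod n) :=
  SimpleGraph.fromRel fun p q => q.1 = p.1 ∧ q.2 = p.2 + 1

/-- The sum of the path weights of `T` over all sequences of length `n + 1`, weighted by a function
of the endpoints, is given by the entries of `T ^ n`. -/
theorem sum_prod_path_eq {ι R : Type*} [Fintype ι] [DecidableEq ι] [CommRing R]
    (T : Matrix ι ι R) (n : ℕ) (g : ι → ι → R) :
    ∑ f : Fin (n + 1) → ι, (∏ a : Fin n, T (f a.castSucc) (f a.succ)) * g (f 0) (f (Fin.last n)) =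
      ∑ i, ∑ j, (T ^ n) i j * g i j := by
  induction n generalizing g with
  | zero =>
    rw [← (Equiv.funUnique (Fin 1) ι).symm.sum_comp]
    simp [Matrix.one_apply]
  | succ n ih =>
    rw [← (Fin.consEquiv fun _ : Fin (n + 2) => ι).sum_comp, Fintype.sum_prod_type_right]
    have h : ∀ f : Fin (n + 1) → ι,
        ∑ x : ι, (∏ a : Fin (n + 1), T (Fin.consEquiv (fun _ : Fin (n + 2) => ι) (x, f) a.castSucc)
            (Fin.consEquiv (fun _ : Fin (n + 2) => ι) (x, f) a.succ)) *
          g (Fin.consEquiv (fun _ : Fin (n + 2) => ι) (x, f) 0)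
            (Fin.consEquiv (fun _ : Fin (n + 2) => ι) (x, f) (Fin.last (n + 1))) =
        (∏ a : Fin n, T (f a.castSucc) (f a.succ)) *
          ∑ x : ι, T x (f 0) * g x (f (Fin.last n)) := by
      intro f
      rw [Finset.mul_sum]
      refine Finset.sum_congr rfl fun x _ => ?_
      rw [Fin.prod_univ_succ]
      simp only [Fin.consEquiv_apply, Fin.castSucc_zero, Fin.cons_zero, Fin.cons_succ,
        ← Fin.succ_castSucc, ← Fin.succ_last]
      ring
    refine (Finset.sum_congr rfl fun f _ => h f).trans ?_
    rw [ih fun i j => ∑ x, T x i * g x j]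
    simp only [pow_succ', Matrix.mul_apply, Finset.mul_sum, Finset.sum_mul]
    rw [Finset.sum_congr rfl fun i _ => Finset.sum_comm, Finset.sum_comm]
    refine Finset.sum_congr rfl fun x _ => ?_
    rw [Finset.sum_comm]
    exact Finset.sum_congr rfl fun j _ => Finset.sum_congr rfl fun i _ => by ring

/-- The transfer-matrix formula for closed walks indexed by `ZMod n`. -/
theorem sum_prod_zmod_eq_trace_pow {ι R : Type*} [Fintype ι] [DecidableEq ι] [CommRing R]
    (T : Matrix ι ι R) (n : ℕ) [NeZero n] :
    ∑ f : ZMod n → ι, ∏ a, T (f a) (f (a + 1)) = (T ^ n).trace := by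
  obtain ⟨n, rfl⟩ := Nat.exists_eq_succ_of_ne_zero (NeZero.ne n)
  change ∑ f : Fin (n + 1) → ι, ∏ a : Fin (n + 1), T (f a) (f (a + 1)) = (T ^ (n + 1)).trace
  simp only [Fin.prod_univ_castSucc, Fin.coeSucc_eq_succ, Fin.last_add_one]
  rw [sum_prod_path_eq T n fun i j => T j i]
  simp [Matrix.trace, pow_succ, Matrix.mul_apply]

/-- The transfer matrix of the independent sets of edges of a cycle: `true` marks a chosen edge. -/
def matchingTransfer : Matrix Bool Bool ℤ[X] :=
  fun b c => if b then (if c then 0 else X) else 1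

theorem prod_matchingTransfer {α : Type*} [Fintype α] (σ : α → α) (f : α → Bool)
    [Decidable (∀ a, f a = true → f (σ a) = false)] :
    ∏ a, matchingTransfer (f a) (f (σ a)) =
      if ∀ a, f a = true → f (σ a) = false then
        X ^ (Finset.univ.filter fun a => f a = true).card else 0 := by
  split_ifs with h
  · have h' : ∀ a, matchingTransfer (f a) (f (σ a)) = if f a = true then X else 1 := by
      intro a
      cases ha : f a
      · simp [matchingTransfer]
      · simp [matchingTransfer, h a ha]
    simp [h', Finset.prod_ite]
  · push Not at h
    obtain ⟨a, ha, hσ⟩ := h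
    exact Finset.prod_eq_zero (Finset.mem_univ a) (by simp_all [matchingTransfer])

/-- If `σ` is injective without points of period one or two, then the matchings of its functional
graph are counted by the transfer matrix. -/
theorem matchingCount_fromRel_eq_coeff {α : Type*} [Fintype α] [DecidableEq α] (σ : α → α)
    (hσ : Function.Injective σ) (h₁ : ∀ a, σ a ≠ a) (h₂ : ∀ a, σ (σ a) ≠ a) (m : ℕ) :
    (matchingCount (SimpleGraph.fromRel fun a b => b = σ a) m : ℤ) =
      (∑ f : α → Bool, ∏ a, matchingTransfer (f a) (f (σ a))).coeff m := by
  classical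
  have he : Function.Injective fun a => s(a, σ a) := by
    intro a b hab
    rcases Sym2.eq_iff.1 hab with h | ⟨h, h'⟩
    · exact h.1
    · exact absurd (by rw [← h, h']) (h₂ b)
  have hedge : ∀ e, e ∈ (SimpleGraph.fromRel fun a b => b = σ a).edgeSet ↔ ∃ a, s(a, σ a) = e := by
    intro e
    induction e with | _ x y =>
    simp only [SimpleGraph.mem_edgeSet, SimpleGraph.fromRel_adj]
    constructor
    · rintro ⟨-, rfl | rfl⟩
      · exact ⟨x, rfl⟩
      · exact ⟨y, Sym2.eq_swap⟩
    · rintro ⟨a, h⟩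
      rcases Sym2.eq_iff.1 h with ⟨rfl, rfl⟩ | ⟨rfl, rfl⟩
      · exact ⟨(h₁ a).symm, .inl rfl⟩
      · exact ⟨h₁ a, .inr rfl⟩
  simp only [prod_matchingTransfer, Polynomial.finsetSum_coeff]
  have hc : ∀ f : α → Bool, (if ∀ a, f a = true → f (σ a) = false then
        (X : ℤ[X]) ^ (Finset.univ.filter fun a => f a = true).card else 0).coeff m =
      if (Finset.univ.filter fun a => f a = true).card = m ∧ ∀ a, f a = true → f (σ a) = false
        then 1 else 0 := by
    intro f
    by_cases hf : ∀ a, f a = true → f (σ a) = false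
    · simp only [if_pos hf, Polynomial.coeff_X_pow, and_iff_left hf, @eq_comm ℕ m]
    · simp only [Polynomial.coeff_zero, hf, and_false, if_false]
  rw [Finset.sum_congr rfl fun f _ => hc f, Finset.sum_boole, matchingCount,
    Nat.card_eq_fintype_card, Fintype.card_subtype]
  congr 1
  symm
  refine Finset.card_bij
    (fun f _ => (Finset.univ.filter fun a => f a = true).image fun a => s(a, σ a)) ?_ ?_ ?_
  · intro f hf
    simp only [Finset.mem_filter, Finset.mem_univ, true_and] at hf ⊢
    refine ⟨by rw [Finset.card_image_of_injective _ he, hf.1], ?_, ?_⟩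
    · intro e h
      obtain ⟨a, -, rfl⟩ := Finset.mem_image.1 h
      exact (hedge _).2 ⟨a, rfl⟩
    · intro e h e' h' hne v hv hv'
      obtain ⟨a, ha, rfl⟩ := Finset.mem_image.1 h
      obtain ⟨b, hb, rfl⟩ := Finset.mem_image.1 h'
      simp only [Finset.mem_filter, Finset.mem_univ, true_and] at ha hb
      rcases Sym2.mem_iff.1 hv with rfl | rfl <;> rcases Sym2.mem_iff.1 hv' with h | h
      · exact hne (by rw [h])
      · have := hf.2 b hb
        rw [← h, ha] at this
        cases this
      · have := hf.2 a ha
        rw [h, hb] at this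
        cases this
      · exact hne (by rw [hσ h])
  · intro f _ g _ h
    have := Finset.image_injective he h
    funext a
    have ha := Finset.ext_iff.1 this a
    simp only [Finset.mem_filter, Finset.mem_univ, true_and] at ha
    exact Bool.eq_iff_iff.2 ha
  · intro M hM
    simp only [Finset.mem_filter, Finset.mem_univ, true_and] at hM
    obtain ⟨hcard, hG, hdisj⟩ := hM
    have himg : ((Finset.univ.filter fun a => decide (s(a, σ a) ∈ M) = true).image
        fun a => s(a, σ a)) = M := by
      ext e
      simp only [Finset.mem_image, Finset.mem_filter, Finset.mem_univ, true_and, decide_eq_true_eq]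
      constructor
      · rintro ⟨a, ha, rfl⟩
        exact ha
      · intro h
        obtain ⟨a, rfl⟩ := (hedge e).1 (hG e h)
        exact ⟨a, h, rfl⟩
    refine ⟨fun a => decide (s(a, σ a) ∈ M), ?_, himg⟩
    simp only [Finset.mem_filter, Finset.mem_univ, true_and]
    refine ⟨?_, ?_⟩
    · rw [← hcard, ← Finset.card_image_of_injective _ he, himg]
    · intro a ha
      simp only [decide_eq_true_eq, decide_eq_false_iff_not] at ha ⊢
      exact fun hb => hdisj _ ha _ hb (fun h => h₁ a (he h).symm) (σ a) (Sym2.mem_mk_right _ _)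
        (Sym2.mem_mk_left _ _)

theorem ZMod.add_one_ne_self {n : ℕ} (hn : 3 ≤ n) (a : ZMod n) : a + 1 ≠ a := by
  have : Fact (1 < n) := ⟨by omega⟩
  simp

theorem ZMod.add_one_add_one_ne_self {n : ℕ} (hn : 3 ≤ n) (a : ZMod n) : a + 1 + 1 ≠ a := by
  intro h
  have h2 : ((2 : ℕ) : ZMod n) = 0 := by
    push_cast
    linear_combination h
  exact absurd (Nat.le_of_dvd (by norm_num) ((ZMod.natCast_eq_zero_iff 2 n).1 h2)) (by omega)

theorem matchingCount_cycleGraph_eq_coeff {n : ℕ} (hn : 3 ≤ n) (m : ℕ) :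
    (matchingCount (cycleGraph n) m : ℤ) = ((matchingTransfer ^ n).trace).coeff m := by
  have : NeZero n := ⟨by omega⟩
  rw [← sum_prod_zmod_eq_trace_pow]
  exact matchingCount_fromRel_eq_coeff (fun a : ZMod n => a + 1) (add_left_injective 1)
    (ZMod.add_one_ne_self hn) (ZMod.add_one_add_one_ne_self hn) m

theorem matchingCount_cyclesUnion_eq_coeff (l : ℕ) {n : ℕ} (hn : 3 ≤ n) (m : ℕ) :
    (matchingCount (cyclesUnion l n) m : ℤ) = ((matchingTransfer ^ n).trace ^ l).coeff m := by
  have : NeZero n := ⟨by omega⟩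
  have hG : cyclesUnion l n =
      SimpleGraph.fromRel fun p q : Fin l × ZMod n => q = (p.1, p.2 + 1) := by
    simp only [cyclesUnion, Prod.ext_iff]
  rw [hG, matchingCount_fromRel_eq_coeff (fun p : Fin l × ZMod n => (p.1, p.2 + 1)),
    ← sum_prod_zmod_eq_trace_pow, Fintype.sum_pow,
    ← (Equiv.curry (Fin l) (ZMod n) Bool).symm.sum_comp]
  · simp [Fintype.prod_prod_type]
  · rintro ⟨i, a⟩ ⟨j, b⟩ h
    simpa using h
  · exact fun p h => ZMod.add_one_ne_self hn p.2 (Prod.ext_iff.1 h).2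
  · exact fun p h => ZMod.add_one_add_one_ne_self hn p.2 (Prod.ext_iff.1 h).2

theorem trace_pow_add_two {R : Type*} [CommRing R] (A : Matrix Bool Bool R) (k : ℕ) :
    (A ^ (k + 2)).trace = A.trace * (A ^ (k + 1)).trace - A.det * (A ^ k).trace := by
  have h : A ^ 2 = A.trace • A - A.det • 1 := by
    rw [← Matrix.det_reindex_self finTwoEquiv.symm A, Matrix.det_fin_two]
    ext i j
    cases i <;> cases j <;>
      simp [pow_two, Matrix.mul_apply, Matrix.trace, finTwoEquiv] <;> ring
  rw [pow_add, h, mul_sub, Matrix.mul_smul, Matrix.mul_smul, Matrix.trace_sub, Matrix.trace_smul,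
    Matrix.trace_smul, ← pow_succ, mul_one, smul_eq_mul, smul_eq_mul]

theorem trace_matchingTransfer : matchingTransfer.trace = 1 := by
  simp [Matrix.trace, matchingTransfer]

theorem det_matchingTransfer : matchingTransfer.det = -X := by
  rw [← Matrix.det_reindex_self finTwoEquiv.symm, Matrix.det_fin_two]
  simp [matchingTransfer, finTwoEquiv]

theorem trace_matchingTransfer_pow_add_two (k : ℕ) :
    (matchingTransfer ^ (k + 2)).trace =
      (matchingTransfer ^ (k + 1)).trace + X * (matchingTransfer ^ k).trace := by
  rw [trace_pow_add_two, trace_matchingTransfer, det_matchingTransfer]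
  ring

theorem coeff_trace_matchingTransfer_pow_eq_zero (k i : ℕ) (h : k < 2 * i) :
    ((matchingTransfer ^ k).trace).coeff i = 0 := by
  induction k using Nat.twoStepInduction generalizing i with
  | zero =>
    obtain ⟨i, rfl⟩ := Nat.exists_eq_succ_of_ne_zero (show i ≠ 0 by omega)
    simp [Matrix.trace_one]
  | one => simp [trace_matchingTransfer, Polynomial.coeff_one, show i ≠ 0 by omega]
  | more k ih₀ ih₁ =>
    obtain ⟨i, rfl⟩ := Nat.exists_eq_succ_of_ne_zero (show i ≠ 0 by omega)
    rw [trace_matchingTransfer_pow_add_two, Polynomial.coeff_add, Polynomial.coeff_X_mul,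
      ih₀ i (by omega), ih₁ (i + 1) (by omega), add_zero]

/-- The trace of a power of a `2 × 2` matrix in terms of its trace and determinant. -/
theorem trace_pow_eq_sum {R : Type*} [CommRing R] (A : Matrix Bool Bool R) (k N : ℕ) (h : k < N) :
    (A ^ k).trace = ∑ i ∈ Finset.range N,
      (((matchingTransfer ^ k).trace).coeff i : R) * (-A.det) ^ i * A.trace ^ (k - 2 * i) := by
  induction k using Nat.twoStepInduction generalizing N with
  | zero =>
    obtain ⟨N, rfl⟩ := Nat.exists_eq_succ_of_ne_zero (show N ≠ 0 by omega)
    rw [Finset.sum_range_succ', Finset.sum_eq_zero fun i _ => by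
      rw [coeff_trace_matchingTransfer_pow_eq_zero _ _ (by omega)]; simp]
    simp [Matrix.trace_one]
  | one =>
    obtain ⟨N, rfl⟩ := Nat.exists_eq_succ_of_ne_zero (show N ≠ 0 by omega)
    rw [Finset.sum_range_succ', Finset.sum_eq_zero fun i _ => by
      rw [coeff_trace_matchingTransfer_pow_eq_zero _ _ (by omega)]; simp]
    simp [trace_matchingTransfer]
  | more k ih₀ ih₁ =>
    obtain ⟨N, rfl⟩ := Nat.exists_eq_succ_of_ne_zero (show N ≠ 0 by omega)
    have hs : ∀ i, A.trace * ((((matchingTransfer ^ (k + 1)).trace).coeff i : R) * (-A.det) ^ i *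
          A.trace ^ (k + 1 - 2 * i)) =
        (((matchingTransfer ^ (k + 1)).trace).coeff i : R) * (-A.det) ^ i *
          A.trace ^ (k + 2 - 2 * i) := by
      intro i
      rcases lt_or_ge (k + 1) (2 * i) with hi | hi
      · simp [coeff_trace_matchingTransfer_pow_eq_zero _ _ hi]
      · rw [show k + 2 - 2 * i = (k + 1 - 2 * i) + 1 by omega, pow_succ]
        ring
    rw [trace_pow_add_two, ih₀ N (by omega), ih₁ (N + 1) (by omega), Finset.mul_sum,
      Finset.sum_congr rfl fun i _ => hs i, Finset.sum_range_succ', Finset.sum_range_succ',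
      trace_matchingTransfer_pow_add_two, Polynomial.coeff_add, Polynomial.mul_coeff_zero,
      Polynomial.coeff_X_zero, zero_mul, add_zero, add_sub_right_comm, Finset.mul_sum,
      ← Finset.sum_sub_distrib]
    congr 1
    refine Finset.sum_congr rfl fun i _ => ?_
    rw [Polynomial.coeff_add, Polynomial.coeff_X_mul, show k + 2 - 2 * (i + 1) = k - 2 * i by omega]
    push_cast
    ring

/-- `a(C_{kn}, m) = Σ_{i=0}^{⌊m/n⌋} (−1)^{i(n−1)} a(C_k, i) a((k−2i)·C_n, m − i·n)`. -/
theorem matchingCount_cycle_mul (k n m : ℕ) (hk : 3 ≤ k) (hn : 3 ≤ n) :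
    (matchingCount (cycleGraph (k * n)) m : ℤ) =
      ∑ i ∈ Finset.range (m / n + 1),
        (-1 : ℤ) ^ (i * (n - 1)) * matchingCount (cycleGraph k) i *
          matchingCount (cyclesUnion (k - 2 * i) n) (m - i * n) := by
  have hdet : -(matchingTransfer ^ n).det = ((-1) ^ (n - 1) * X ^ n : ℤ[X]) := by
    obtain ⟨n, rfl⟩ := Nat.exists_eq_succ_of_ne_zero (show n ≠ 0 by omega)
    rw [Matrix.det_pow, det_matchingTransfer, neg_pow (X : ℤ[X])]
    simp only [Nat.succ_eq_add_one, Nat.add_sub_cancel]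
    ring
  rw [matchingCount_cycleGraph_eq_coeff (by nlinarith), mul_comm k n, pow_mul,
    trace_pow_eq_sum _ k (m / n + 1 + k) (Nat.lt_add_of_pos_left (Nat.succ_pos _)),
    Polynomial.finsetSum_coeff, hdet]
  have hterm : ∀ i, (((((matchingTransfer ^ k).trace).coeff i : ℤ) : ℤ[X]) *
        ((-1) ^ (n - 1) * X ^ n) ^ i * (matchingTransfer ^ n).trace ^ (k - 2 * i)).coeff m =
      if n * i ≤ m then (-1 : ℤ) ^ (i * (n - 1)) * matchingCount (cycleGraph k) i *
        matchingCount (cyclesUnion (k - 2 * i) n) (m - i * n) else 0 := by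
    intro i
    have hC : ((((matchingTransfer ^ k).trace).coeff i : ℤ) : ℤ[X]) *
        ((-1) ^ (n - 1) * X ^ n) ^ i * (matchingTransfer ^ n).trace ^ (k - 2 * i) =
        Polynomial.C ((-1 : ℤ) ^ (i * (n - 1)) * ((matchingTransfer ^ k).trace).coeff i) *
          (X ^ (n * i) * (matchingTransfer ^ n).trace ^ (k - 2 * i)) := by
      simp only [map_mul, map_pow, map_neg, map_one, ← Polynomial.C_eq_intCast, Int.cast_id]
      ring
    rw [hC, Polynomial.coeff_C_mul, Polynomial.coeff_X_pow_mul',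
      matchingCount_cycleGraph_eq_coeff hk, matchingCount_cyclesUnion_eq_coeff _ hn, mul_comm i n,
      mul_ite, mul_zero]
  rw [Finset.sum_congr rfl fun i _ => hterm i, Finset.sum_range_add,
    Finset.sum_congr rfl fun i hi => if_pos ?_, Finset.sum_eq_zero fun i _ => if_neg ?_, add_zero]
  · rw [not_le, mul_comm]
    exact (Nat.div_lt_iff_lt_mul (by omega)).1 (by omega)
  · rw [mul_comm]
    exact (Nat.le_div_iff_mul_le (by omega)).1 (Nat.le_of_lt_succ (Finset.mem_range.1 hi))
end
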